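/- Let β > 1 and let ν be the Ising model with interaction matrix (β/d)B, where B is the adjacency matrix of a d-regular ε-expander on n nodes. Let m(x) = (1/n)Σ_i x^i and let m* > 0 solve m* = tanh(βm*). For every δ ∈ (0,1) there exist c(δ) > 0 and ε_0(δ) > 0 such that if ε < ε_0(δ), then ν({x : |m(x) − m*| > δ and |m(x) + m*| > δ}) ≤ C₁(β) e^{−c(δ)n}. -/

import Mathlib

open Finset
open scoped Matrix

/-- Spin value ±1 of a Boolean coordinate. -/
noncomputable def spin (b : Bool) : ℝ := if b then 1 else -1

/-- The ±1 spin vector associated to a Boolean configuration. -/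
noncomputable def sigmaVec {n : ℕ} (x : Fin n → Bool) : Fin n → ℝ := fun i => spin (x i)

/-- The Ising model with interaction matrix `J`: `π_J(x) ∝ exp((1/2) xᵀ J x)`. -/
noncomputable def ising {n : ℕ} (J : Matrix (Fin n) (Fin n) ℝ) (x : Fin n → Bool) : ℝ :=
  Real.exp ((1 / 2) * (sigmaVec x ⬝ᵥ J.mulVec (sigmaVec x))) /
    ∑ y, Real.exp ((1 / 2) * (sigmaVec y ⬝ᵥ J.mulVec (sigmaVec y)))

/-- Average magnetization `m(x) = (1/n) Σ_i x^i`. -/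
noncomputable def magAvg {n : ℕ} (x : Fin n → Bool) : ℝ := (∑ i, spin (x i)) / n

/-- The exponential rate `log (2 cosh βγ) - βγ²/2` of the contribution of magnetization `γ` to the
Curie–Weiss partition function. -/
noncomputable def magRate (β γ : ℝ) : ℝ :=
  Real.log (2 * Real.cosh (β * γ)) - β * γ ^ 2 / 2

theorem tanh_div_self_strictAntiOn :
    StrictAntiOn (fun x : ℝ => Real.tanh x / x) (Set.Ioi 0) := by
  have hderiv : ∀ x ∈ Set.Ioi (0 : ℝ), HasDerivAt (fun x : ℝ => Real.tanh x / x)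
      ((x - Real.sinh x * Real.cosh x) / (Real.cosh x * x) ^ 2) x := by
    intro x hx
    have hx0 : x ≠ 0 := ne_of_gt hx
    have hc : Real.cosh x ≠ 0 := (Real.cosh_pos x).ne'
    have h := ((Real.hasDerivAt_sinh x).div (Real.hasDerivAt_cosh x) hc).div (hasDerivAt_id x) hx0
    refine (h.congr_deriv ?_).congr_of_eventuallyEq
      (Filter.Eventually.of_forall fun y => ?_)
    · have := Real.cosh_sq x
      simp only [id, Pi.div_apply]
      field_simp
      rw [this]
      ring
    · simp [Real.tanh_eq_sinh_div_cosh]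
  refine strictAntiOn_of_deriv_neg (convex_Ioi 0)
    (fun x hx => (hderiv x hx).continuousAt.continuousWithinAt) fun x hx => ?_
  rw [interior_Ioi] at hx
  rw [(hderiv x hx).deriv]
  have hx' : 0 < x := hx
  refine div_neg_of_neg_of_pos ?_ (pow_pos (mul_pos (Real.cosh_pos x) hx') 2)
  nlinarith [Real.self_lt_sinh_iff.2 hx', Real.one_le_cosh x]

theorem hasDerivAt_magRate (β γ : ℝ) :
    HasDerivAt (magRate β) (β * (Real.tanh (β * γ) - γ)) γ := by
  have hc : Real.cosh (β * γ) ≠ 0 := (Real.cosh_pos _).ne'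
  have h1 : HasDerivAt (fun y : ℝ => β * y) β γ := by
    simpa using (hasDerivAt_id γ).const_mul β
  have h := ((h1.cosh.const_mul 2).log (mul_ne_zero two_ne_zero hc)).sub
    (((hasDerivAt_pow 2 γ).const_mul β).div_const 2)
  refine h.congr_deriv ?_
  rw [Real.tanh_eq_sinh_div_cosh]
  field_simp
  norm_num
  ring

theorem continuous_magRate (β : ℝ) : Continuous (magRate β) :=
  continuous_iff_continuousAt.2 fun γ => (hasDerivAt_magRate β γ).continuousAt

theorem magRate_abs (β γ : ℝ) : magRate β |γ| = magRate β γ := by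
  rcases abs_choice γ with h | h <;> rw [h]
  simp [magRate]

/-- Positive solutions of the mean-field equation are unique. -/
theorem eq_of_tanh_mul_eq_self {β a b : ℝ} (hβ : 0 < β) (ha : 0 < a) (hb : 0 < b)
    (hat : Real.tanh (β * a) = a) (hbt : Real.tanh (β * b) = b) : a = b := by
  have h : β * a = β * b := by
    refine tanh_div_self_strictAntiOn.injOn (mul_pos hβ ha) (mul_pos hβ hb) ?_
    simp only [hat, hbt]
    field_simp
  exact mul_left_cancel₀ hβ.ne' h

theorem lt_tanh_mul_iff {β m γ : ℝ} (hβ : 0 < β) (hm : 0 < m) (hmt : Real.tanh (β * m) = m)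
    (hγ : 0 < γ) : γ < Real.tanh (β * γ) ↔ γ < m := by
  have h := tanh_div_self_strictAntiOn.lt_iff_gt (a := β * m) (b := β * γ)
    (mul_pos hβ hm) (mul_pos hβ hγ)
  simp only [hmt] at h
  rw [mul_lt_mul_iff_right₀ hβ, show m / (β * m) = 1 / β by field_simp,
    div_lt_div_iff₀ hβ (mul_pos hβ hγ)] at h
  rw [← h, one_mul, mul_comm, mul_lt_mul_iff_left₀ hβ]

theorem magRate_lt {β m γ : ℝ} (hβ : 0 < β) (hm : 0 < m) (hmt : Real.tanh (β * m) = m)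
    (h₁ : γ ≠ m) (h₂ : γ ≠ -m) : magRate β γ < magRate β m := by
  rw [← magRate_abs β γ]
  have hne : |γ| ≠ m := fun h => by
    rcases (abs_eq hm.le).1 h with h | h
    exacts [h₁ h, h₂ h]
  have hderiv : ∀ y, deriv (magRate β) y = β * (Real.tanh (β * y) - y) :=
    fun y => (hasDerivAt_magRate β y).deriv
  rcases lt_or_gt_of_ne hne with h | h
  · refine strictMonoOn_of_deriv_pos (convex_Icc 0 m) (continuous_magRate β).continuousOn
      (fun y hy => ?_) ⟨abs_nonneg γ, h.le⟩ ⟨hm.le, le_rfl⟩ h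
    rw [interior_Icc] at hy
    rw [hderiv]
    exact mul_pos hβ (sub_pos.2 ((lt_tanh_mul_iff hβ hm hmt hy.1).2 hy.2))
  · refine strictAntiOn_of_deriv_neg (convex_Ici m) (continuous_magRate β).continuousOn
      (fun y hy => ?_) (Set.mem_Ici.2 le_rfl) (Set.mem_Ici.2 h.le) h
    rw [interior_Ici] at hy
    have hy' : m < y := hy
    rw [hderiv]
    refine mul_neg_of_pos_of_neg hβ (sub_neg.2 (lt_of_le_of_ne ?_ fun he => ?_))
    · exact not_lt.1 fun hlt => hy'.not_gt ((lt_tanh_mul_iff hβ hm hmt (hm.trans hy')).1 hlt)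
    · exact hy'.ne (eq_of_tanh_mul_eq_self hβ hm (hm.trans hy') hmt he)

/-- The rate stays a definite amount below its maximum away from `±m`. -/
theorem exists_magRate_gap {β m δ : ℝ} (hβ : 0 < β) (hm : 0 < m)
    (hmt : Real.tanh (β * m) = m) (hδ : 0 < δ) :
    ∃ κ, 0 < κ ∧ ∀ γ, |γ| ≤ 1 → δ < |γ - m| → δ < |γ + m| →
      magRate β γ ≤ magRate β m - κ := by
  set K : Set ℝ := Set.Icc (-1) 1 ∩ {γ | δ ≤ |γ - m| ∧ δ ≤ |γ + m|}
  have hKc : IsCompact K := isCompact_Icc.inter_right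
    (IsClosed.and (isClosed_le continuous_const (by fun_prop))
      (isClosed_le continuous_const (by fun_prop)))
  rcases K.eq_empty_or_nonempty with he | hne
  · refine ⟨1, one_pos, fun γ h₁ h₂ h₃ => ?_⟩
    exact absurd (show γ ∈ K from ⟨abs_le.1 h₁, h₂.le, h₃.le⟩) (by simp [he])
  · obtain ⟨γ₀, ⟨-, h₀, h₀'⟩, hmax⟩ :=
      hKc.exists_isMaxOn hne (continuous_magRate β).continuousOn
    refine ⟨magRate β m - magRate β γ₀, sub_pos.2 (magRate_lt hβ hm hmt ?_ ?_),
      fun γ h₁ h₂ h₃ => ?_⟩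
    · rintro rfl
      simp at h₀
      linarith
    · rintro rfl
      simp at h₀'
      linarith
    · have := hmax (show γ ∈ K from ⟨abs_le.1 h₁, h₂.le, h₃.le⟩)
      simp only [Set.mem_ofPred_eq] at this
      linarith

theorem sum_exp_mul_spin (n : ℕ) (t : ℝ) :
    ∑ x : Fin n → Bool, Real.exp (t * ∑ i, spin (x i)) = (2 * Real.cosh t) ^ n := by
  have h : 2 * Real.cosh t = ∑ b : Bool, Real.exp (t * spin b) := by
    simp [spin, Real.cosh_eq]
    ring
  rw [h, Fintype.sum_pow]
  simp [Finset.mul_sum, Real.exp_sum]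

theorem natCast_mul_magAvg {n : ℕ} (hn : 0 < n) (x : Fin n → Bool) :
    n * magAvg x = ∑ i, spin (x i) := by
  have : (n : ℝ) ≠ 0 := by positivity
  rw [magAvg]
  field_simp

theorem sum_exp_linear {n : ℕ} (hn : 0 < n) (β γ : ℝ) :
    ∑ x : Fin n → Bool, Real.exp (n * (β * γ * magAvg x - β * γ ^ 2 / 2)) =
      Real.exp (n * magRate β γ) := by
  have hc : 0 < 2 * Real.cosh (β * γ) := mul_pos two_pos (Real.cosh_pos _)
  calc _ = ∑ x : Fin n → Bool, Real.exp (β * γ * ∑ i, spin (x i)) *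
        Real.exp (-(n * (β * γ ^ 2 / 2))) := by
        refine sum_congr rfl fun x _ => ?_
        rw [← natCast_mul_magAvg hn, ← Real.exp_add]
        ring_nf
    _ = _ := by
        rw [← sum_mul, sum_exp_mul_spin, magRate, mul_sub, sub_eq_add_neg, Real.exp_add,
          Real.exp_nat_mul, Real.exp_log hc]

theorem exp_magRate_le_sum {n : ℕ} (hn : 0 < n) {β : ℝ} (hβ : 0 < β) (γ : ℝ) :
    Real.exp (n * magRate β γ) ≤
      ∑ x : Fin n → Bool, Real.exp (n * (β * magAvg x ^ 2 / 2)) := by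
  rw [← sum_exp_linear hn]
  refine sum_le_sum fun x _ => Real.exp_le_exp.2 (mul_le_mul_of_nonneg_left ?_ n.cast_nonneg)
  nlinarith [mul_nonneg hβ.le (sq_nonneg (magAvg x - γ))]

theorem abs_magAvg_le_one {n : ℕ} (hn : 0 < n) (x : Fin n → Bool) : |magAvg x| ≤ 1 := by
  rw [magAvg, abs_div, Nat.abs_cast, div_le_one (by positivity)]
  refine (abs_sum_le_sum_abs _ _).trans ?_
  have : ∀ b, |spin b| = 1 := by rintro (_ | _) <;> simp [spin]
  simp [this]

theorem card_image_magAvg_le (n : ℕ) :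
    (univ.image (magAvg : (Fin n → Bool) → ℝ)).card ≤ n + 1 := by
  have h : univ.image (magAvg : (Fin n → Bool) → ℝ) ⊆
      (range (n + 1)).image fun k : ℕ => (2 * (k : ℝ) - n) / n := by
    intro γ hγ
    obtain ⟨x, -, rfl⟩ := mem_image.1 hγ
    refine mem_image.2 ⟨#{i | x i = true}, ?_, ?_⟩
    · have := card_le_univ (univ.filter fun i => x i = true)
      rw [Fintype.card_fin] at this
      exact mem_range.2 (Nat.lt_succ_of_le this)
    · rw [magAvg]
      congr 1
      have : ∀ b : Bool, spin b = 2 * (if b = true then 1 else 0) - 1 := by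
        rintro (_ | _) <;> norm_num [spin]
      simp [this, sum_sub_distrib, ← mul_sum, -mul_ite]
  exact (card_le_card h).trans (card_image_le.trans (card_range _).le)

/-- The configurations whose magnetization satisfies `P` contribute at most `n + 1` times the
largest exponential rate. -/
theorem sum_exp_filter_le {n : ℕ} (hn : 0 < n) {β R : ℝ} (P : ℝ → Prop) [DecidablePred P]
    (hR : ∀ γ, |γ| ≤ 1 → P γ → magRate β γ ≤ R) :
    ∑ x : Fin n → Bool with P (magAvg x), Real.exp (n * (β * magAvg x ^ 2 / 2)) ≤
      (n + 1) * Real.exp (n * R) := by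
  set S := (univ.image (magAvg : (Fin n → Bool) → ℝ)).filter P
  have hcard : (#S : ℝ) ≤ n + 1 := by
    exact_mod_cast (card_filter_le _ _).trans (card_image_magAvg_le n)
  calc _ ≤ ∑ x : Fin n → Bool with P (magAvg x),
        ∑ γ ∈ S, Real.exp (n * (β * γ * magAvg x - β * γ ^ 2 / 2)) := by
        refine sum_le_sum fun x hx => ?_
        have hmem : magAvg x ∈ S :=
          mem_filter.2 ⟨mem_image_of_mem _ (mem_univ x), (mem_filter.1 hx).2⟩
        refine le_trans (le_of_eq ?_) (single_le_sum (fun γ _ => (Real.exp_pos _).le) hmem)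
        ring_nf
    _ ≤ ∑ x : Fin n → Bool, ∑ γ ∈ S, Real.exp (n * (β * γ * magAvg x - β * γ ^ 2 / 2)) :=
        sum_le_sum_of_subset_of_nonneg (filter_subset _ _)
          fun x _ _ => sum_nonneg fun γ _ => (Real.exp_pos _).le
    _ = ∑ γ ∈ S, Real.exp (n * magRate β γ) := by
        rw [sum_comm]
        exact sum_congr rfl fun γ _ => sum_exp_linear hn β γ
    _ ≤ ∑ γ ∈ S, Real.exp (n * R) := by
        refine sum_le_sum fun γ hγ =>
          Real.exp_le_exp.2 (mul_le_mul_of_nonneg_left ?_ n.cast_nonneg)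
        obtain ⟨hγ, hP⟩ := mem_filter.1 hγ
        obtain ⟨x, -, rfl⟩ := mem_image.1 hγ
        exact hR _ (abs_magAvg_le_one hn x) hP
    _ ≤ _ := by
        rw [sum_const, nsmul_eq_mul]
        exact mul_le_mul_of_nonneg_right hcard (Real.exp_pos _).le

/-- An expander's quadratic form is close to that of the complete graph. -/
theorem abs_dotProduct_mulVec_sigmaVec_sub_le {n d : ℕ} {ε : ℝ}
    {B : Matrix (Fin n) (Fin n) ℝ} (hn : 0 < n) (hε : 0 ≤ ε) (hB : B.IsSymm)
    (hrow : ∀ i, ∑ j, B i j = d)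
    (hgap : ∀ v : EuclideanSpace ℝ (Fin n), ∑ i, v i = 0 →
      ‖(Matrix.toEuclideanCLM (𝕜 := ℝ) B) v‖ ≤ ε * d * ‖v‖) (x : Fin n → Bool) :
    |sigmaVec x ⬝ᵥ B.mulVec (sigmaVec x) - d * (n * magAvg x ^ 2)| ≤ ε * d * n := by
  set m := magAvg x with hm
  set y : Fin n → ℝ := fun i => sigmaVec x i - m with hy
  have hsum : ∑ i, y i = 0 := by
    simp [hy, sigmaVec, ← natCast_mul_magAvg hn, hm]
  have hx : sigmaVec x = y + m • 1 := by
    ext i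
    simp [hy]
  have hB1 : B.mulVec 1 = (d : ℝ) • 1 := by
    ext i
    simp [Matrix.mulVec, dotProduct, hrow]
  have hy1 : y ⬝ᵥ 1 = 0 := by simpa [dotProduct] using hsum
  have h1y : 1 ⬝ᵥ B.mulVec y = 0 := by
    rw [Matrix.dotProduct_mulVec, ← Matrix.mulVec_transpose, hB.eq, hB1, smul_dotProduct,
      dotProduct_comm, hy1, smul_zero]
  have h11 : (1 : Fin n → ℝ) ⬝ᵥ 1 = n := by simp [dotProduct]
  have hform : sigmaVec x ⬝ᵥ B.mulVec (sigmaVec x) - d * (n * m ^ 2) = y ⬝ᵥ B.mulVec y := by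
    rw [hx, Matrix.mulVec_add, Matrix.mulVec_smul, hB1]
    simp only [add_dotProduct, dotProduct_add, smul_dotProduct, dotProduct_smul, hy1, h1y, h11,
      smul_eq_mul]
    ring
  set v : EuclideanSpace ℝ (Fin n) := WithLp.toLp 2 y with hv
  have hnorm : ‖v‖ ^ 2 ≤ n := by
    have hs : ∀ i, y i ^ 2 = 1 - 2 * m * y i - m ^ 2 := fun i => by
      have : sigmaVec x i ^ 2 = 1 := by
        rcases h : x i <;> simp [sigmaVec, spin, h]
      have hyi : y i = sigmaVec x i - m := rfl
      rw [← this, hyi]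
      ring
    have : ∑ i, y i ^ 2 = n - n * m ^ 2 := by
      simp only [hs, sum_sub_distrib, ← mul_sum, hsum]
      simp
    rw [EuclideanSpace.real_norm_sq_eq]
    simp only [hv, this]
    nlinarith [mul_nonneg n.cast_nonneg (sq_nonneg m) (α := ℝ)]
  rw [hform, ← Matrix.inner_toEuclideanCLM B v v]
  calc _ ≤ ‖v‖ * ‖(Matrix.toEuclideanCLM (𝕜 := ℝ) B) v‖ := abs_real_inner_le_norm _ _
    _ ≤ ‖v‖ * (ε * d * ‖v‖) := mul_le_mul_of_nonneg_left (hgap v hsum) (norm_nonneg _)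
    _ = ε * d * ‖v‖ ^ 2 := by ring
    _ ≤ _ := mul_le_mul_of_nonneg_left hnorm (by positivity)

/-- A quantity at most `1` and at most `K e^{-bn}` decays exponentially with prefactor `e`. -/
theorem le_exp_one_mul_exp {K b p t : ℝ} (hK : 1 ≤ K) (hp : p ≤ 1)
    (ht : p ≤ K * Real.exp (-b * t)) :
    p ≤ Real.exp 1 * Real.exp (-(b / (1 + Real.log K)) * t) := by
  have hL : 0 ≤ Real.log K := Real.log_nonneg hK
  set c := b / (1 + Real.log K) with hc
  have hb : b = c * (1 + Real.log K) := by rw [hc]; field_simp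
  rw [← Real.exp_add]
  rcases le_total (c * t) 1 with h | h
  · exact hp.trans (Real.one_le_exp (by linarith))
  · refine ht.trans ?_
    nth_rewrite 1 [← Real.exp_log (one_pos.trans_le hK)]
    rw [← Real.exp_add, Real.exp_le_exp, hb]
    nlinarith [mul_nonneg hL (sub_nonneg.2 h)]

theorem abs_ising_exponent_sub_le {n d : ℕ} {β ε : ℝ} {B : Matrix (Fin n) (Fin n) ℝ}
    (hβ : 0 < β) (hn : 0 < n) (hd : 0 < d) (hε : 0 ≤ ε) (hB : B.IsSymm)
    (hrow : ∀ i, ∑ j, B i j = d)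
    (hgap : ∀ v : EuclideanSpace ℝ (Fin n), ∑ i, v i = 0 →
      ‖(Matrix.toEuclideanCLM (𝕜 := ℝ) B) v‖ ≤ ε * d * ‖v‖) (x : Fin n → Bool) :
    |(1 / 2) * (sigmaVec x ⬝ᵥ ((β / d) • B).mulVec (sigmaVec x)) - n * (β * magAvg x ^ 2 / 2)| ≤
      n * (β * ε / 2) := by
  have hd' : (0 : ℝ) < d := by exact_mod_cast hd
  have h := abs_dotProduct_mulVec_sigmaVec_sub_le hn hε hB hrow hgap x
  rw [Matrix.smul_mulVec, dotProduct_smul, smul_eq_mul]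
  set q := sigmaVec x ⬝ᵥ B.mulVec (sigmaVec x)
  calc _ = |β / (2 * d) * (q - d * (n * magAvg x ^ 2))| := by
        congr 1
        field_simp
    _ = β / (2 * d) * |q - d * (n * magAvg x ^ 2)| := by
        rw [abs_mul, abs_of_nonneg (by positivity)]
    _ ≤ β / (2 * d) * (ε * d * n) := mul_le_mul_of_nonneg_left h (by positivity)
    _ = _ := by field_simp

theorem ising_nonneg {n : ℕ} (J : Matrix (Fin n) (Fin n) ℝ) (x : Fin n → Bool) :
    0 ≤ ising J x :=
  div_nonneg (Real.exp_pos _).le (sum_nonneg fun _ _ => (Real.exp_pos _).le)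

theorem sum_ising {n : ℕ} (J : Matrix (Fin n) (Fin n) ℝ) : ∑ x, ising J x = 1 := by
  simp only [ising]
  rw [← sum_div]
  exact div_self (sum_pos (fun _ _ => Real.exp_pos _) univ_nonempty).ne'

theorem sum_ising_filter_le {n d : ℕ} {β ε κ m : ℝ} {B : Matrix (Fin n) (Fin n) ℝ}
    (hβ : 0 < β) (hn : 0 < n) (hd : 0 < d) (hε : 0 ≤ ε) (hB : B.IsSymm)
    (hrow : ∀ i, ∑ j, B i j = d)
    (hgap : ∀ v : EuclideanSpace ℝ (Fin n), ∑ i, v i = 0 →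
      ‖(Matrix.toEuclideanCLM (𝕜 := ℝ) B) v‖ ≤ ε * d * ‖v‖)
    (P : ℝ → Prop) [DecidablePred P]
    (hP : ∀ γ, |γ| ≤ 1 → P γ → magRate β γ ≤ magRate β m - κ) :
    ∑ x : Fin n → Bool with P (magAvg x), ising ((β / d) • B) x ≤
      (n + 1) * Real.exp (-n * (κ - β * ε)) := by
  have hclose := abs_ising_exponent_sub_le hβ hn hd hε hB hrow hgap
  set a := n * (β * ε / 2) with ha
  have hZ : Real.exp (-a) * Real.exp (n * magRate β m) ≤
      ∑ y, Real.exp ((1 / 2) * (sigmaVec y ⬝ᵥ ((β / d) • B).mulVec (sigmaVec y))) := by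
    refine (mul_le_mul_of_nonneg_left (exp_magRate_le_sum hn hβ m) (Real.exp_pos _).le).trans ?_
    rw [mul_sum]
    refine sum_le_sum fun y _ => ?_
    rw [← Real.exp_add, Real.exp_le_exp]
    linarith [(abs_le.1 (hclose y)).1]
  have hN : ∑ x : Fin n → Bool with P (magAvg x),
      Real.exp ((1 / 2) * (sigmaVec x ⬝ᵥ ((β / d) • B).mulVec (sigmaVec x))) ≤
      Real.exp a * ((n + 1) * Real.exp (n * (magRate β m - κ))) := by
    refine le_trans ?_ (mul_le_mul_of_nonneg_left (sum_exp_filter_le hn P hP) (Real.exp_pos _).le)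
    rw [mul_sum]
    refine sum_le_sum fun y _ => ?_
    rw [← Real.exp_add, Real.exp_le_exp]
    linarith [(abs_le.1 (hclose y)).2]
  simp only [ising]
  rw [← sum_div, div_le_iff₀ ((mul_pos (Real.exp_pos _) (Real.exp_pos _)).trans_le hZ)]
  refine hN.trans (le_trans (le_of_eq ?_) (mul_le_mul_of_nonneg_left hZ (by positivity)))
  rw [mul_left_comm, mul_assoc, ← Real.exp_add, ← Real.exp_add, ← Real.exp_add, ha]
  ring_nf

theorem natCast_add_one_le_mul_exp {a K : ℝ} (hK : 1 ≤ K) (haK : 1 ≤ K * a) (n : ℕ) :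
    (n : ℝ) + 1 ≤ K * Real.exp (a * n) := by
  have h := mul_le_mul_of_nonneg_left (Real.add_one_le_exp (a * n)) (zero_le_one.trans hK)
  nlinarith [mul_nonneg (sub_nonneg.2 haK) n.cast_nonneg (α := ℝ)]

open scoped Classical in
theorem stmt16 (β : ℝ) (hβ : 1 < β) :
    ∃ C₁ : ℝ, 0 < C₁ ∧ ∀ δ : ℝ, 0 < δ → δ < 1 →
      ∃ c ε₀ : ℝ, 0 < c ∧ 0 < ε₀ ∧
        ∀ (n d : ℕ) (ε : ℝ) (B : Matrix (Fin n) (Fin n) ℝ) (mstar : ℝ),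
          0 < n → 0 < d → 0 < ε → ε < ε₀ →
          B.IsSymm → (∀ i, B i i = 0) → (∀ i j, B i j = 0 ∨ B i j = 1) →
          (∀ i, ∑ j, B i j = d) →
          (∀ v : EuclideanSpace ℝ (Fin n), ∑ i, v i = 0 →
            ‖(Matrix.toEuclideanCLM (𝕜 := ℝ) B) v‖ ≤ ε * d * ‖v‖) →
          0 < mstar → Real.tanh (β * mstar) = mstar →
          (∑ x : Fin n → Bool,
              if δ < |magAvg x - mstar| ∧ δ < |magAvg x + mstar| then
                ising ((β / d) • B) x else 0)
            ≤ C₁ * Real.exp (-c * n) := by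
  have hβ0 : 0 < β := one_pos.trans hβ
  refine ⟨Real.exp 1, Real.exp_pos 1, fun δ hδ _ => ?_⟩
  by_cases hex : ∃ m : ℝ, 0 < m ∧ Real.tanh (β * m) = m
  swap
  · exact ⟨1, 1, one_pos, one_pos, fun n d ε B m _ _ _ _ _ _ _ _ _ hm hmt =>
      absurd ⟨m, hm, hmt⟩ hex⟩
  obtain ⟨m, hm, hmt⟩ := hex
  obtain ⟨κ, hκ, hgapκ⟩ := exists_magRate_gap hβ0 hm hmt hδ
  set K := max 1 (4 / κ)
  have hK1 : 1 ≤ K := le_max_left _ _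
  have hKκ : 1 ≤ K * (κ / 4) := by
    have := mul_le_mul_of_nonneg_right (le_max_right 1 (4 / κ)) (show 0 ≤ κ / 4 by positivity)
    rwa [show 4 / κ * (κ / 4) = 1 by field_simp] at this
  refine ⟨κ / 4 / (1 + Real.log K), κ / (2 * β),
    div_pos (by positivity) (by linarith [Real.log_nonneg hK1]), by positivity, ?_⟩
  intro n d ε B m' hn hd hε hεlt hB _ _ hrow hgap hm' hmt'
  obtain rfl := eq_of_tanh_mul_eq_self hβ0 hm hm' hmt hmt'
  have hβε : β * ε ≤ κ / 2 := by
    rw [lt_div_iff₀ (by positivity)] at hεlt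
    linarith
  rw [← sum_filter]
  refine le_exp_one_mul_exp hK1 ?_ ?_
  · rw [← sum_ising ((β / d) • B)]
    exact sum_le_sum_of_subset_of_nonneg (filter_subset _ _) fun x _ _ => ising_nonneg _ x
  · refine (sum_ising_filter_le hβ0 hn hd hε.le hB hrow hgap
      (fun γ => δ < |γ - m| ∧ δ < |γ + m|) fun γ h h' => hgapκ γ h h'.1 h'.2).trans ?_
    refine (mul_le_mul_of_nonneg_right (natCast_add_one_le_mul_exp hK1 hKκ n)
      (Real.exp_pos _).le).trans ?_
    rw [mul_assoc, ← Real.exp_add]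
    refine mul_le_mul_of_nonneg_left (Real.exp_le_exp.2 ?_) (by linarith)
    nlinarith [mul_nonneg n.cast_nonneg (sub_nonneg.2 hβε) (α := ℝ)]
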